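/- (Quadratic growth near the free boundary.) Let φ₋, φ₊ : ℝ^d → ℝ be non-constant C², (2πℤ)^d-periodic functions with φ₊ − φ₋ ≥ τ everywhere for some τ > 0, assume max φ₋ > min φ₊, and let u be the unique continuous periodic solution of the double obstacle problem, with contact sets M₋(u) = {u = φ₋}, M₊(u) = {u = φ₊} and free boundaries ∂M₋(u), ∂M₊(u). Then there exist constants C₀, C > 0 such that: for every x with dist(x, ∂M₋(u)) ≤ 1/C₀ one has 0 ≤ u(x) − φ₋(x) ≤ C·‖Δφ₋‖_{L^∞}·dist(x, ∂M₋(u))², and for every x with dist(x, ∂M₊(u)) ≤ 1/C₀ one has 0 ≤ φ₊(x) − u(x) ≤ C·‖Δφ₊‖_{L^∞}·dist(x, ∂M₊(u))². -/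

import Mathlib

open MeasureTheory Real

noncomputable section

/-- Euclidean space `ℝ^d`. -/
abbrev Rd (d : ℕ) := EuclideanSpace ℝ (Fin d)

/-- `f : ℝ^d → α` is `(2πℤ)^d`-periodic. -/
def PeriodicRd {d : ℕ} {α : Type*} (f : Rd d → α) : Prop :=
  ∀ (x : Rd d) (j : Fin d),
    f (x + (2 * Real.pi) • EuclideanSpace.single j (1 : ℝ)) = f x

/-- The Euclidean Laplacian `Δ = ∑ ∂²/∂xⱼ²`. -/
noncomputable def lapRd {d : ℕ} (f : Rd d → ℝ) (x : Rd d) : ℝ :=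
  ∑ j : Fin d,
    fderiv ℝ (fun y => fderiv ℝ f y (EuclideanSpace.single j (1 : ℝ))) x
      (EuclideanSpace.single j (1 : ℝ))

/-- The fundamental domain `E = [0,2π)^d`. -/
def EfdR (d : ℕ) : Set (Rd d) := {x | ∀ j : Fin d, x j ∈ Set.Ico 0 (2 * Real.pi)}

/-- `u` is a solution of the double obstacle problem with obstacles `φ₋ ≤ u ≤ φ₊`:
`u` is continuous, periodic, trapped between the obstacles, distributionally
subharmonic on `{u > φ₋}` and distributionally superharmonic on `{u < φ₊}`. -/
def IsDOPSolution {d : ℕ} (φm φp u : Rd d → ℝ) : Prop :=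
  Continuous u ∧ PeriodicRd u ∧ (∀ x, φm x ≤ u x ∧ u x ≤ φp x) ∧
    (∀ χ : Rd d → ℝ, ContDiff ℝ (⊤ : ℕ∞) χ → HasCompactSupport χ → (∀ x, 0 ≤ χ x) →
      tsupport χ ⊆ {x | φm x < u x} → 0 ≤ ∫ x : Rd d, u x * lapRd χ x) ∧
    (∀ χ : Rd d → ℝ, ContDiff ℝ (⊤ : ℕ∞) χ → HasCompactSupport χ → (∀ x, 0 ≤ χ x) →
      tsupport χ ⊆ {x | u x < φp x} → (∫ x : Rd d, u x * lapRd χ x) ≤ 0)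

/-! ### A smooth radial test function and the associated averaging kernel -/

/-- The derivative of `expNegInvGlue`. -/
def glueDeriv (s : ℝ) : ℝ := deriv expNegInvGlue s

lemma contDiff_glueDeriv {n : ℕ∞} : ContDiff ℝ n glueDeriv := by
  have h : ContDiff ℝ ((⊤ : ℕ∞) + 1) expNegInvGlue := expNegInvGlue.contDiff (n := ⊤)
  exact ((contDiff_succ_iff_deriv.1 h).2.2).of_le (by exact_mod_cast le_top)

lemma hasDerivAt_expNegInvGlue (s : ℝ) : HasDerivAt expNegInvGlue (glueDeriv s) s :=
  ((expNegInvGlue.contDiff (n := 1)).differentiable (by simp) s).hasDerivAt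

lemma hasDerivAt_glueDeriv (s : ℝ) : HasDerivAt glueDeriv (deriv glueDeriv s) s :=
  ((contDiff_glueDeriv (n := 1)).differentiable (by simp) s).hasDerivAt

lemma continuous_glueDeriv : Continuous glueDeriv := (contDiff_glueDeriv (n := 0)).continuous

lemma continuous_deriv_glueDeriv : Continuous (deriv glueDeriv) :=
  (contDiff_glueDeriv (n := 1)).continuous_deriv (by simp)

lemma glueDeriv_eq (s : ℝ) : glueDeriv s = s⁻¹ ^ 2 * expNegInvGlue s := by
  have h := expNegInvGlue.hasDerivAt_polynomial_eval_inv_mul 1 s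
  simp only [Polynomial.eval_one, one_mul, Polynomial.derivative_one, sub_zero, mul_one,
    Polynomial.eval_pow, Polynomial.eval_X] at h
  exact h.deriv

lemma glueDeriv_nonneg (s : ℝ) : 0 ≤ glueDeriv s := by
  rw [glueDeriv_eq]
  exact mul_nonneg (sq_nonneg _) (expNegInvGlue.nonneg s)

lemma glueDeriv_pos {s : ℝ} (hs : 0 < s) : 0 < glueDeriv s := by
  rw [glueDeriv_eq]
  exact mul_pos (by positivity) (expNegInvGlue.pos_of_pos hs)

lemma glueDeriv_of_nonpos {s : ℝ} (hs : s ≤ 0) : glueDeriv s = 0 := by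
  rw [glueDeriv_eq, expNegInvGlue.zero_of_nonpos hs, mul_zero]

lemma deriv_glueDeriv_of_nonpos {s : ℝ} (hs : s ≤ 0) : deriv glueDeriv s = 0 := by
  have hclosed : IsClosed {s : ℝ | deriv glueDeriv s = 0} :=
    isClosed_eq continuous_deriv_glueDeriv continuous_const
  have hsub : Set.Iio (0 : ℝ) ⊆ {s : ℝ | deriv glueDeriv s = 0} := fun r hr => by
    have : glueDeriv =ᶠ[nhds r] fun _ => 0 := by
      filter_upwards [Iio_mem_nhds hr] with x hx using glueDeriv_of_nonpos (le_of_lt hx)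
    simp [this.deriv_eq]
  have := hclosed.closure_subset_iff.2 hsub
  rw [closure_Iio] at this
  exact this hs

variable {d : ℕ}

/-- The radial test function `expNegInvGlue (1 - |x - y|² / t²)`, supported in the closed ball
of radius `t` about `y`. -/
def radialTest (y : Rd d) (t : ℝ) (x : Rd d) : ℝ := expNegInvGlue (1 - ‖x - y‖ ^ 2 / t ^ 2)

/-- The (unnormalized) averaging kernel at scale `t` about `y`. -/
def avgKernel (y : Rd d) (t : ℝ) (x : Rd d) : ℝ := (t ^ d)⁻¹ * glueDeriv (1 - ‖x - y‖ ^ 2 / t ^ 2)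

/-- The total mass of `avgKernel`. -/
def avgMass (d : ℕ) : ℝ := ∫ z : Rd d, glueDeriv (1 - ‖z‖ ^ 2)

lemma one_sub_sq_div_nonpos {t a : ℝ} (ht : 0 < t) (ha : t ≤ a) : 1 - a ^ 2 / t ^ 2 ≤ 0 := by
  rw [sub_nonpos, one_le_div (by positivity)]
  exact pow_le_pow_left₀ ht.le ha 2

lemma hasFDerivAt_one_sub_sq_div (y : Rd d) (t : ℝ) (x : Rd d) :
    HasFDerivAt (fun x : Rd d => 1 - ‖x - y‖ ^ 2 / t ^ 2)
      ((-2 / t ^ 2) • innerSL ℝ (x - y)) x := by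
  have h := (((hasStrictFDerivAt_norm_sq (x - y)).hasFDerivAt.comp x
    ((hasFDerivAt_id x).sub_const y)).const_mul (t ^ 2)⁻¹).const_sub 1
  refine (h.congr_fderiv ?_).congr_of_eventuallyEq ?_
  · ext v
    simp
    ring
  · exact Filter.Eventually.of_forall fun z => by simp [div_eq_inv_mul]

lemma fderiv_radialTest_single (y : Rd d) (t : ℝ) (x : Rd d) (j : Fin d) :
    fderiv ℝ (radialTest y t) x (EuclideanSpace.single j 1)
      = glueDeriv (1 - ‖x - y‖ ^ 2 / t ^ 2) * ((-2 / t ^ 2) * (x j - y j)) := by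
  have h := (hasDerivAt_expNegInvGlue _).comp_hasFDerivAt x (hasFDerivAt_one_sub_sq_div y t x)
  have h' : HasFDerivAt (radialTest y t) _ x := h
  rw [h'.fderiv]
  simp [EuclideanSpace.inner_single_right]

lemma lapRd_radialTest (y : Rd d) (t : ℝ) (x : Rd d) :
    lapRd (radialTest y t) x = deriv glueDeriv (1 - ‖x - y‖ ^ 2 / t ^ 2) *
      (4 * ‖x - y‖ ^ 2 / t ^ 4) - glueDeriv (1 - ‖x - y‖ ^ 2 / t ^ 2) * (2 * d / t ^ 2) := by
  have hj (j : Fin d) :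
      fderiv ℝ (fun z => fderiv ℝ (radialTest y t) z (EuclideanSpace.single j 1)) x
        (EuclideanSpace.single j 1) = deriv glueDeriv (1 - ‖x - y‖ ^ 2 / t ^ 2) *
          (4 / t ^ 4) * ‖(x - y) j‖ ^ 2 - glueDeriv (1 - ‖x - y‖ ^ 2 / t ^ 2) * (2 / t ^ 2) := by
    simp_rw [fderiv_radialTest_single]
    have h1 := (hasDerivAt_glueDeriv _).comp_hasFDerivAt x (hasFDerivAt_one_sub_sq_div y t x)
    have h2 : HasFDerivAt (fun z : Rd d => (-2 / t ^ 2) * (z j - y j))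
        ((-2 / t ^ 2) • (EuclideanSpace.proj j : Rd d →L[ℝ] ℝ)) x :=
      (((EuclideanSpace.proj j : Rd d →L[ℝ] ℝ).hasFDerivAt).sub_const (y j)).const_mul _
    have h3 := h1.fun_mul h2
    simp only [Function.comp_def] at h3
    rw [HasFDerivAt.fderiv h3]
    simp [EuclideanSpace.inner_single_right]
    ring
  simp_rw [lapRd, hj]
  rw [Finset.sum_sub_distrib, ← Finset.mul_sum, ← EuclideanSpace.norm_sq_eq]
  simp
  ring

lemma contDiff_radialTest {n : ℕ∞} (y : Rd d) (t : ℝ) : ContDiff ℝ n (radialTest y t) := by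
  refine expNegInvGlue.contDiff.comp ?_
  exact contDiff_const.sub (((contDiff_id.sub contDiff_const).norm_sq ℝ).div_const _)

lemma radialTest_nonneg (y : Rd d) (t : ℝ) (x : Rd d) : 0 ≤ radialTest y t x :=
  expNegInvGlue.nonneg _

lemma tsupport_radialTest_subset (y : Rd d) {t : ℝ} (ht : 0 < t) :
    tsupport (radialTest y t) ⊆ Metric.closedBall y t := by
  refine closure_minimal (fun x hx => ?_) Metric.isClosed_closedBall
  by_contra hxt
  rw [Metric.mem_closedBall, dist_eq_norm, not_le] at hxt
  exact hx (expNegInvGlue.zero_of_nonpos (one_sub_sq_div_nonpos ht hxt.le))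

lemma hasCompactSupport_radialTest (y : Rd d) {t : ℝ} (ht : 0 < t) :
    HasCompactSupport (radialTest y t) :=
  (isCompact_closedBall y t).of_isClosed_subset (isClosed_tsupport _)
    (tsupport_radialTest_subset y ht)

lemma avgKernel_nonneg (y : Rd d) {t : ℝ} (ht : 0 < t) (x : Rd d) : 0 ≤ avgKernel y t x :=
  mul_nonneg (by positivity) (glueDeriv_nonneg _)

lemma avgKernel_eq_zero (y : Rd d) {t : ℝ} (ht : 0 < t) {x : Rd d} (hx : t ≤ ‖x - y‖) :
    avgKernel y t x = 0 := by
  rw [avgKernel, glueDeriv_of_nonpos (one_sub_sq_div_nonpos ht hx), mul_zero]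

lemma continuous_avgKernel (y : Rd d) (t : ℝ) : Continuous (avgKernel y t) :=
  continuous_const.mul (continuous_glueDeriv.comp (by fun_prop))

lemma lapRd_radialTest_eq_zero (y : Rd d) {t : ℝ} (ht : 0 < t) {x : Rd d} (hx : t ≤ ‖x - y‖) :
    lapRd (radialTest y t) x = 0 := by
  have h := one_sub_sq_div_nonpos ht hx
  rw [lapRd_radialTest, glueDeriv_of_nonpos h, deriv_glueDeriv_of_nonpos h]
  ring

lemma continuous_lapRd_radialTest (y : Rd d) (t : ℝ) : Continuous (lapRd (radialTest y t)) := by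
  have h1 := continuous_glueDeriv
  have h2 := continuous_deriv_glueDeriv
  rw [funext (lapRd_radialTest y t)]
  fun_prop

lemma hasDerivAt_avgKernel (y : Rd d) {t : ℝ} (ht : 0 < t) (x : Rd d) :
    HasDerivAt (fun s => avgKernel y s x)
      (t / 2 * (t ^ d)⁻¹ * lapRd (radialTest y t) x) t := by
  have ht0 : t ≠ 0 := ht.ne'
  have h1 : HasDerivAt (fun s : ℝ => 1 - ‖x - y‖ ^ 2 / s ^ 2) (2 * ‖x - y‖ ^ 2 / t ^ 3) t := by
    have := (((hasDerivAt_pow 2 t).inv (by positivity)).const_mul (‖x - y‖ ^ 2)).const_sub 1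
    refine this.congr_deriv ?_
    simp
    field_simp
  have h2 := (hasDerivAt_glueDeriv _).comp t h1
  have h3 := ((hasDerivAt_pow d t).inv (by positivity)).mul h2
  refine h3.congr_deriv ?_
  rw [lapRd_radialTest]
  have hd : (d : ℝ) * t ^ (d - 1) = d * t ^ d / t := by
    rcases d with _ | n
    · simp
    · field_simp
      simp [pow_succ]
  simp only [Function.comp, hd, Pi.inv_apply]
  field_simp
  ring

lemma hasCompactSupport_of_eq_zero_of_le_norm {f : Rd d → ℝ} (y : Rd d) (t : ℝ)
    (h : ∀ x, t ≤ ‖x - y‖ → f x = 0) : HasCompactSupport f := by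
  refine HasCompactSupport.intro (isCompact_closedBall y t) fun x hx => h x ?_
  rw [Metric.mem_closedBall, dist_eq_norm, not_le] at hx
  exact hx.le

lemma integrable_mul_avgKernel {v : Rd d → ℝ} (hv : Continuous v) (y : Rd d) {t : ℝ}
    (ht : 0 < t) : Integrable fun x => v x * avgKernel y t x :=
  (hv.mul (continuous_avgKernel y t)).integrable_of_hasCompactSupport
    (hasCompactSupport_of_eq_zero_of_le_norm y t fun x hx => by
      simp [avgKernel_eq_zero y ht hx])

lemma integrable_mul_lapRd_radialTest {v : Rd d → ℝ} (hv : Continuous v) (y : Rd d) {t : ℝ}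
    (ht : 0 < t) : Integrable fun x => v x * lapRd (radialTest y t) x :=
  (hv.mul (continuous_lapRd_radialTest y t)).integrable_of_hasCompactSupport
    (hasCompactSupport_of_eq_zero_of_le_norm y t fun x hx => by
      simp [lapRd_radialTest_eq_zero y ht hx])

lemma avgMass_pos (d : ℕ) : 0 < avgMass d := by
  refine Continuous.integral_pos_of_hasCompactSupport_nonneg_nonzero (x := 0)
    (continuous_glueDeriv.comp (by fun_prop)) ?_ (fun z => glueDeriv_nonneg _) ?_
  · refine hasCompactSupport_of_eq_zero_of_le_norm 0 1 fun z hz => glueDeriv_of_nonpos ?_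
    rw [sub_zero] at hz
    nlinarith
  · exact (glueDeriv_pos (by simp)).ne'

lemma integral_mul_avgKernel (v : Rd d → ℝ) (y : Rd d) {t : ℝ} (ht : 0 < t) :
    ∫ x, v x * avgKernel y t x = ∫ z : Rd d, v (y + t • z) * glueDeriv (1 - ‖z‖ ^ 2) := by
  have h := Measure.integral_comp_smul (volume : Measure (Rd d))
    (fun x => v (y + x) * glueDeriv (1 - ‖x‖ ^ 2 / t ^ 2)) t
  have hnorm (z : Rd d) : ‖t • z‖ ^ 2 / t ^ 2 = ‖z‖ ^ 2 := by
    rw [norm_smul, mul_pow, norm_eq_abs, sq_abs]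
    field_simp
  simp only [hnorm] at h
  rw [h, finrank_euclideanSpace_fin, abs_of_pos (by positivity), smul_eq_mul,
    ← integral_const_mul, ← integral_add_left_eq_self _ y]
  refine integral_congr_ae (Filter.Eventually.of_forall fun x => ?_)
  simp only [avgKernel, add_sub_cancel_left]
  ring

lemma integral_avgKernel (y : Rd d) {t : ℝ} (ht : 0 < t) :
    ∫ x, avgKernel y t x = avgMass d := by
  simpa [avgMass] using integral_mul_avgKernel (fun _ => 1) y ht

lemma hasDerivAt_integral_mul_avgKernel {v : Rd d → ℝ} (hv : Continuous v) (y : Rd d) {t : ℝ}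
    (ht : 0 < t) :
    HasDerivAt (fun s => ∫ x, v x * avgKernel y s x)
      (t / 2 * (t ^ d)⁻¹ * ∫ x, v x * lapRd (radialTest y t) x) t := by
  set s : Set ℝ := Set.Icc (t / 2) (2 * t)
  have hs0 : ∀ r ∈ s, 0 < r := fun r hr => by linarith [hr.1]
  set k : Set (Rd d) := Metric.closedBall y (2 * t)
  have hcont : ContinuousOn
      (fun p : ℝ × Rd d => v p.2 * (p.1 / 2 * (p.1 ^ d)⁻¹ * lapRd (radialTest y p.1) p.2))
      (s ×ˢ k) := by
    have h1 := continuous_glueDeriv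
    have h2 := continuous_deriv_glueDeriv
    simp_rw [lapRd_radialTest]
    have hne : ∀ p ∈ s ×ˢ k, p.1 ≠ 0 := fun p hp => (hs0 _ hp.1).ne'
    have hne' : ∀ n : ℕ, ∀ p ∈ s ×ˢ k, p.1 ^ n ≠ 0 := fun n p hp => pow_ne_zero _ (hne p hp)
    have h3 : ContinuousOn (fun p : ℝ × Rd d => 1 - ‖p.2 - y‖ ^ 2 / p.1 ^ 2) (s ×ˢ k) :=
      continuousOn_const.sub (ContinuousOn.div (by fun_prop) (by fun_prop) (hne' 2))
    have h4 := h1.comp_continuousOn h3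
    have h5 := h2.comp_continuousOn h3
    refine ContinuousOn.mul (by fun_prop) (ContinuousOn.mul (ContinuousOn.mul (by fun_prop)
      (ContinuousOn.inv₀ (by fun_prop) (hne' d))) ((h5.mul ?_).sub (h4.mul ?_)))
    · exact ContinuousOn.div (by fun_prop) (by fun_prop) (hne' 4)
    · exact ContinuousOn.div (by fun_prop) (by fun_prop) (hne' 2)
  obtain ⟨M, hM⟩ := (isCompact_Icc.prod
    (isCompact_closedBall y (2 * t))).exists_bound_of_continuousOn hcont
  have key := hasDerivAt_integral_of_dominated_loc_of_deriv_le (μ := (volume : Measure (Rd d)))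
    (F := fun s x => v x * avgKernel y s x) (x₀ := t) (s := s) (bound := k.indicator fun _ => M)
    (F' := fun r x => v x * (r / 2 * (r ^ d)⁻¹ * lapRd (radialTest y r) x))
    (Icc_mem_nhds (by linarith) (by linarith))
    (Filter.Eventually.of_forall fun r =>
      (hv.mul (continuous_avgKernel y r)).aestronglyMeasurable)
    (integrable_mul_avgKernel hv y ht)
    (hv.mul (continuous_const.mul (continuous_lapRd_radialTest y t))).aestronglyMeasurable
    (Filter.Eventually.of_forall fun x r hr => ?_)
    ((integrable_indicator_iff Metric.isClosed_closedBall.measurableSet).2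
      (integrableOn_const (isCompact_closedBall y (2 * t)).measure_lt_top.ne))
    (Filter.Eventually.of_forall fun x r hr =>
      (hasDerivAt_avgKernel y (hs0 r hr) x).const_mul (v x))
  · refine key.2.congr_deriv ?_
    rw [← integral_const_mul]
    refine integral_congr_ae (Filter.Eventually.of_forall fun x => ?_)
    simp only
    ring
  · by_cases hx : x ∈ k
    · rw [Set.indicator_of_mem hx]
      exact hM (r, x) ⟨hr, hx⟩
    · have hx' : r ≤ ‖x - y‖ := by
        rw [Metric.mem_closedBall, dist_eq_norm, not_le] at hx
        exact hr.2.trans hx.le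
      simp [Set.indicator_of_notMem hx, lapRd_radialTest_eq_zero y (hs0 r hr) hx']

/-- Mean value inequality: if the continuous function `v` is superharmonic when tested against
the radial test functions about `y` of scale at most `R`, then its weighted averages about `y`
are bounded by its value at `y`. -/
lemma integral_mul_avgKernel_le {v : Rd d → ℝ} (hv : Continuous v) (y : Rd d) {R : ℝ}
    (hR : 0 < R) (h : ∀ t, 0 < t → t ≤ R → ∫ x, v x * lapRd (radialTest y t) x ≤ 0) :
    ∫ x, v x * avgKernel y R x ≤ avgMass d * v y := by
  set A : ℝ → ℝ := fun t => ∫ z : Rd d, v (y + t • z) * glueDeriv (1 - ‖z‖ ^ 2) with hA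
  have hcont : ContinuousOn A Set.univ := by
    refine continuousOn_integral_of_compact_support (isCompact_closedBall (0 : Rd d) 1) ?_ ?_
    · have := continuous_glueDeriv
      exact Continuous.continuousOn (by unfold Function.uncurry; fun_prop)
    · intro t z _ hz
      rw [mem_closedBall_zero_iff, not_le] at hz
      rw [glueDeriv_of_nonpos (by nlinarith), mul_zero]
  have hderiv : ∀ t ∈ Set.Ioo 0 R, HasDerivAt A
      (t / 2 * (t ^ d)⁻¹ * ∫ x, v x * lapRd (radialTest y t) x) t := fun t ht => by
    refine (hasDerivAt_integral_mul_avgKernel hv y ht.1).congr_of_eventuallyEq ?_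
    filter_upwards [Ioi_mem_nhds ht.1] with r hr
    exact (integral_mul_avgKernel v y hr).symm
  have hanti : AntitoneOn A (Set.Icc 0 R) := by
    refine antitoneOn_of_deriv_nonpos (convex_Icc 0 R) (hcont.mono (Set.subset_univ _)) ?_ ?_
    · rw [interior_Icc]
      exact fun t ht => (hderiv t ht).differentiableAt.differentiableWithinAt
    · rw [interior_Icc]
      intro t ht
      have ht0 := ht.1
      rw [(hderiv t ht).deriv]
      exact mul_nonpos_of_nonneg_of_nonpos (by positivity) (h t ht.1 ht.2.le)
  have h0R := hanti (Set.left_mem_Icc.2 hR.le) (Set.right_mem_Icc.2 hR.le) hR.le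
  have hA0 : A 0 = avgMass d * v y := by
    simp [hA, avgMass, integral_const_mul, mul_comm]
  rw [integral_mul_avgKernel v y hR, ← hA0]
  exact h0R

/-! ### Integration by parts and the mean value inequality with right-hand side -/

lemma ContDiff.fderiv_single {n : ℕ∞} {f : Rd d → ℝ} (hf : ContDiff ℝ (n + 1) f) (j : Fin d) :
    ContDiff ℝ n fun y => fderiv ℝ f y (EuclideanSpace.single j (1 : ℝ)) :=
  (hf.fderiv_right le_rfl).clm_apply contDiff_const

lemma continuous_lapRd {f : Rd d → ℝ} (hf : ContDiff ℝ 2 f) : Continuous (lapRd f) := by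
  refine continuous_finsetSum _ fun j _ => ?_
  have h1 : ContDiff ℝ (1 : ℕ∞) fun y => fderiv ℝ f y (EuclideanSpace.single j (1 : ℝ)) :=
    ContDiff.fderiv_single (n := 1) (by simpa [one_add_one_eq_two] using hf) j
  exact (ContDiff.fderiv_single (n := 0) (by simpa using h1) j).continuous

lemma lapRd_neg (f : Rd d → ℝ) (x : Rd d) : lapRd (fun y => -f y) x = -lapRd f x := by
  simp [lapRd, fderiv_fun_neg]

lemma integral_mul_fderiv_single {f g : Rd d → ℝ} (hf : ContDiff ℝ 1 f) (hg : ContDiff ℝ 1 g)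
    (hc : HasCompactSupport g) (j : Fin d) :
    ∫ x, f x * fderiv ℝ g x (EuclideanSpace.single j 1)
      = -∫ x, fderiv ℝ f x (EuclideanSpace.single j 1) * g x := by
  have hf' : Continuous fun x => fderiv ℝ f x (EuclideanSpace.single j 1) :=
    (hf.continuous_fderiv (by simp)).clm_apply continuous_const
  have hg' : Continuous fun x => fderiv ℝ g x (EuclideanSpace.single j 1) :=
    (hg.continuous_fderiv (by simp)).clm_apply continuous_const
  refine integral_mul_fderiv_eq_neg_fderiv_mul_of_integrable ?_ ?_ ?_
    (fun x _ => hf.differentiable (by simp) x) (fun x _ => hg.differentiable (by simp) x)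
  · exact (hf'.mul hg.continuous).integrable_of_hasCompactSupport hc.mul_left
  · exact (hf.continuous.mul hg').integrable_of_hasCompactSupport
      (hc.fderiv_apply ℝ _).mul_left
  · exact (hf.continuous.mul hg.continuous).integrable_of_hasCompactSupport hc.mul_left

/-- Green's identity for a compactly supported test function. -/
lemma integral_mul_lapRd {f g : Rd d → ℝ} (hf : ContDiff ℝ 2 f) (hg : ContDiff ℝ 2 g)
    (hc : HasCompactSupport g) : ∫ x, f x * lapRd g x = ∫ x, lapRd f x * g x := by
  have hf1 (j : Fin d) : ContDiff ℝ 1 fun y => fderiv ℝ f y (EuclideanSpace.single j (1 : ℝ)) :=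
    ContDiff.fderiv_single (n := 1) (by simpa [one_add_one_eq_two] using hf) j
  have hg1 (j : Fin d) : ContDiff ℝ 1 fun y => fderiv ℝ g y (EuclideanSpace.single j (1 : ℝ)) :=
    ContDiff.fderiv_single (n := 1) (by simpa [one_add_one_eq_two] using hg) j
  have hf2 (j : Fin d) := (ContDiff.fderiv_single (n := 0) (by simpa using hf1 j) j).continuous
  have hg2 (j : Fin d) := (ContDiff.fderiv_single (n := 0) (by simpa using hg1 j) j).continuous
  simp only [lapRd, Finset.mul_sum, Finset.sum_mul]
  rw [integral_finsetSum, integral_finsetSum]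
  · refine Finset.sum_congr rfl fun j _ => ?_
    rw [integral_mul_fderiv_single (hf.of_le (by norm_num)) (hg1 j) (hc.fderiv_apply ℝ _) j,
      integral_mul_fderiv_single (hf1 j) (hg.of_le (by norm_num)) hc j, neg_neg]
  · exact fun j _ => ((hf2 j).mul hg.continuous).integrable_of_hasCompactSupport hc.mul_left
  · exact fun j _ => (hf.continuous.mul (hg2 j)).integrable_of_hasCompactSupport
      ((hc.fderiv_apply ℝ _).fderiv_apply ℝ _).mul_left

lemma lapRd_add_const_mul_norm_sq {f : Rd d → ℝ} (hf : ContDiff ℝ 2 f) (K : ℝ) (y x : Rd d) :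
    lapRd (fun z => f z + K * ‖z - y‖ ^ 2) x = lapRd f x + 2 * d * K := by
  have hf1 (j : Fin d) : ContDiff ℝ 1 fun y => fderiv ℝ f y (EuclideanSpace.single j (1 : ℝ)) :=
    ContDiff.fderiv_single (n := 1) (by simpa [one_add_one_eq_two] using hf) j
  have h1 (j : Fin d) (z : Rd d) :
      fderiv ℝ (fun z => f z + K * ‖z - y‖ ^ 2) z (EuclideanSpace.single j 1)
        = fderiv ℝ f z (EuclideanSpace.single j 1) + 2 * K * (z j - y j) := by
    have h := (hf.differentiable (by simp) z).hasFDerivAt.fun_add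
      (((hasStrictFDerivAt_norm_sq (z - y)).hasFDerivAt.comp z
        ((hasFDerivAt_id z).sub_const y)).const_mul K)
    simp only [Function.comp_def, id] at h
    rw [h.fderiv]
    simp [EuclideanSpace.inner_single_right]
    ring
  have h2 (j : Fin d) : fderiv ℝ (fun z => fderiv ℝ f z (EuclideanSpace.single j 1)
      + 2 * K * (z j - y j)) x (EuclideanSpace.single j 1)
        = fderiv ℝ (fun z => fderiv ℝ f z (EuclideanSpace.single j 1)) x
          (EuclideanSpace.single j 1) + 2 * K := by
    have h := ((hf1 j).differentiable (by simp) x).hasFDerivAt.fun_add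
      ((((EuclideanSpace.proj j : Rd d →L[ℝ] ℝ).hasFDerivAt (x := x)).sub_const (y j)).const_mul
        (2 * K))
    simp only [PiLp.proj_apply] at h
    rw [h.fderiv]
    simp
  simp_rw [lapRd, h1, h2]
  rw [Finset.sum_add_distrib]
  simp
  ring

/-- Mean value inequality for `v - f`, with `v` superharmonic and `f` of class `C²` with Laplacian
bounded below by `-K`. -/
lemma integral_sub_mul_avgKernel_le (hd : 1 ≤ d) {v f : Rd d → ℝ} (hv : Continuous v)
    (hf : ContDiff ℝ 2 f) {K : ℝ} (hK : 0 ≤ K) (hlap : ∀ x, -K ≤ lapRd f x) (y : Rd d) {R : ℝ}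
    (hR : 0 < R) (h : ∀ t, 0 < t → t ≤ R → ∫ x, v x * lapRd (radialTest y t) x ≤ 0) :
    ∫ x, (v x - f x) * avgKernel y R x ≤ avgMass d * (v y - f y + K * R ^ 2) := by
  set g : Rd d → ℝ := fun z => f z + K * ‖z - y‖ ^ 2
  have hg : ContDiff ℝ 2 g :=
    hf.add (contDiff_const.mul ((contDiff_id.sub contDiff_const).norm_sq ℝ))
  have hvg : Continuous fun x => v x - g x := hv.sub hg.continuous
  have hgpos (x : Rd d) : 0 ≤ lapRd g x := by
    rw [lapRd_add_const_mul_norm_sq hf]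
    have : (1 : ℝ) ≤ d := by exact_mod_cast hd
    nlinarith [hlap x]
  have hmean := integral_mul_avgKernel_le hvg y hR fun t ht htR => by
    simp only [sub_mul]
    rw [integral_sub (integrable_mul_lapRd_radialTest hv y ht)
      (integrable_mul_lapRd_radialTest hg.continuous y ht),
      integral_mul_lapRd hg (contDiff_radialTest (n := 2) y t)
        (hasCompactSupport_radialTest y ht)]
    have := integral_nonneg (μ := volume) (f := fun x => lapRd g x * radialTest y t x)
      fun x => mul_nonneg (hgpos x) (radialTest_nonneg y t x)
    linarith [h t ht htR]
  have hle : ∫ x, (v x - f x) * avgKernel y R x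
      ≤ ∫ x, ((v x - g x) * avgKernel y R x + K * R ^ 2 * avgKernel y R x) := by
    refine integral_mono (integrable_mul_avgKernel (hv.sub hf.continuous) y hR)
      ((integrable_mul_avgKernel hvg y hR).add
        (integrable_mul_avgKernel continuous_const y hR)) fun x => ?_
    simp only [← add_mul]
    rcases le_or_gt R ‖x - y‖ with hx | hx
    · simp [avgKernel_eq_zero y hR hx]
    · refine mul_le_mul_of_nonneg_right ?_ (avgKernel_nonneg y hR x)
      have : ‖x - y‖ ^ 2 ≤ R ^ 2 := pow_le_pow_left₀ (norm_nonneg _) hx.le 2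
      simp only [g]
      nlinarith
  rw [integral_add (integrable_mul_avgKernel hvg y hR)
    (integrable_mul_avgKernel continuous_const y hR), integral_const_mul,
    integral_avgKernel y hR] at hle
  have hgy : g y = f y := by simp [g]
  rw [hgy] at hmean
  linarith

/-! ### Periodic functions -/

lemma PeriodicRd.exists_translate_mem_closedBall :
    ∃ R : ℝ, ∀ x : Rd d, ∃ p : Rd d, x + p ∈ Metric.closedBall 0 R ∧
      ∀ {α : Type} (f : Rd d → α), PeriodicRd f → ∀ z, f (z + p) = f z := by
  refine ⟨∑ _j : Fin d, 2 * Real.pi, fun x => ?_⟩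
  set n : Fin d → ℤ := fun j => ⌊x j / (2 * Real.pi)⌋
  refine ⟨∑ j, (-n j) • ((2 * Real.pi) • EuclideanSpace.single j (1 : ℝ)), ?_, ?_⟩
  · have hx : x = ∑ j, x j • EuclideanSpace.single j (1 : ℝ) := by
      ext i
      simp [Finset.sum_apply, Pi.single_apply]
    rw [mem_closedBall_zero_iff]
    nth_rw 1 [hx]
    rw [← Finset.sum_add_distrib]
    refine norm_sum_le_of_le _ fun j _ => ?_
    have hpi : 0 < 2 * Real.pi := by positivity
    rw [← Int.cast_smul_eq_zsmul ℝ, smul_smul, ← add_smul, norm_smul,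
      PiLp.norm_single, norm_one, mul_one, Real.norm_eq_abs, abs_le]
    have h1 := Int.floor_le (x j / (2 * Real.pi))
    have h2 := Int.lt_floor_add_one (x j / (2 * Real.pi))
    rw [le_div_iff₀ hpi] at h1
    rw [div_lt_iff₀ hpi] at h2
    push_cast
    constructor <;> nlinarith
  · intro α f hf
    have (s : Finset (Fin d)) : Function.Periodic f
        (∑ j ∈ s, (-n j) • ((2 * Real.pi) • EuclideanSpace.single j (1 : ℝ))) := by
      induction s using Finset.induction_on with
      | empty => simp [Function.Periodic]
      | insert j s hj ih =>
        rw [Finset.sum_insert hj]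
        exact (Function.Periodic.zsmul (fun x => hf x j) (-n j)).add_period ih
    exact this Finset.univ

lemma PeriodicRd.exists_forall_le {f : Rd d → ℝ} (hf : PeriodicRd f) (hc : Continuous f) :
    ∃ y, ∀ x, f y ≤ f x := by
  obtain ⟨R, hR⟩ := PeriodicRd.exists_translate_mem_closedBall (d := d)
  have hne : (Metric.closedBall (0 : Rd d) R).Nonempty :=
    let ⟨p, hp, _⟩ := hR 0
    ⟨_, hp⟩
  obtain ⟨y, -, hy⟩ := (isCompact_closedBall (0 : Rd d) R).exists_isMinOn hne hc.continuousOn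
  refine ⟨y, fun x => ?_⟩
  obtain ⟨p, hp, hper⟩ := hR x
  rw [← hper f hf x]
  exact hy hp

lemma PeriodicRd.neg {f : Rd d → ℝ} (hf : PeriodicRd f) : PeriodicRd fun x => -f x :=
  fun x j => congrArg Neg.neg (hf x j)

lemma PeriodicRd.bddAbove_range {f : Rd d → ℝ} (hf : PeriodicRd f) (hc : Continuous f) :
    BddAbove (Set.range f) := by
  obtain ⟨y, hy⟩ := hf.neg.exists_forall_le hc.neg
  exact ⟨f y, Set.forall_mem_range.2 fun x => neg_le_neg_iff.1 (hy x)⟩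

lemma PeriodicRd.exists_uniform_delta {f : Rd d → ℝ} (hf : PeriodicRd f) (hc : Continuous f)
    {ε : ℝ} (hε : 0 < ε) : ∃ δ > 0, ∀ x z, dist x z < δ → dist (f x) (f z) < ε := by
  obtain ⟨R, hR⟩ := PeriodicRd.exists_translate_mem_closedBall (d := d)
  obtain ⟨δ, hδ, h⟩ := Metric.mem_uniformity_dist.1
    ((isCompact_closedBall (0 : Rd d) R).uniformContinuousAt_of_continuousAt f
      (fun a _ => hc.continuousAt) (Metric.dist_mem_uniformity hε))
  refine ⟨δ, hδ, fun x z hxz => ?_⟩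
  obtain ⟨p, hp, hper⟩ := hR x
  have := @h (x + p) (z + p) (by simpa using hxz) hp
  simpa [hper f hf] using this

lemma PeriodicRd.lapRd {f : Rd d → ℝ} (hf : PeriodicRd f) : PeriodicRd (lapRd f) := by
  intro x i
  set p : Rd d := (2 * Real.pi) • EuclideanSpace.single i (1 : ℝ)
  have h1 (z : Rd d) : fderiv ℝ f (z + p) = fderiv ℝ f z := by
    rw [← fderiv_comp_add_right]
    exact congrArg (fun g => fderiv ℝ g z) (funext fun w => hf w i)
  refine Finset.sum_congr rfl fun j _ => ?_
  rw [← fderiv_comp_add_right]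
  simp_rw [h1]

/-- A continuous periodic function that is superharmonic on `ℝ^d` is constant. -/
lemma PeriodicRd.eq_of_superharmonic {v : Rd d → ℝ} (hper : PeriodicRd v) (hv : Continuous v)
    (h : ∀ y t, 0 < t → ∫ x, v x * _root_.lapRd (radialTest y t) x ≤ 0) (x z : Rd d) :
    v x = v z := by
  obtain ⟨y, hy⟩ := hper.exists_forall_le hv
  suffices hconst : ∀ x, v x = v y by rw [hconst x, hconst z]
  intro x
  set R : ℝ := ‖x - y‖ + 1
  have hR : 0 < R := by positivity
  have hmean := integral_mul_avgKernel_le hv y hR fun t ht _ => h y t ht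
  have hcont : Continuous fun x => v x - v y := hv.sub continuous_const
  have hle : ∫ x, (v x - v y) * avgKernel y R x ≤ 0 := by
    simp only [sub_mul]
    rw [integral_sub (integrable_mul_avgKernel hv y hR)
      (integrable_mul_avgKernel continuous_const y hR), integral_const_mul,
      integral_avgKernel y hR]
    linarith
  by_contra hne
  refine hle.not_gt (Continuous.integral_pos_of_hasCompactSupport_nonneg_nonzero (x := x)
    (hcont.mul (continuous_avgKernel y R)) ?_ ?_ ?_)
  · exact hasCompactSupport_of_eq_zero_of_le_norm y R fun x hx => by
      simp [avgKernel_eq_zero y hR hx]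
  · exact fun x => mul_nonneg (sub_nonneg.2 (hy x)) (avgKernel_nonneg y hR x)
  · refine mul_ne_zero (sub_ne_zero.2 hne) (mul_pos (by positivity) (glueDeriv_pos ?_)).ne'
    rw [sub_pos, div_lt_one (by positivity)]
    exact pow_lt_pow_left₀ (by simp [R]) (norm_nonneg _) two_ne_zero

/-! ### The double obstacle problem -/

namespace IsDOPSolution

variable {φm φp u : Rd d → ℝ}

lemma neg (h : IsDOPSolution φm φp u) :
    IsDOPSolution (fun x => -φp x) (fun x => -φm x) (fun x => -u x) := by
  obtain ⟨hc, hper, hb, hsub, hsup⟩ := h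
  refine ⟨hc.neg, hper.neg, fun x => ⟨neg_le_neg (hb x).2, neg_le_neg (hb x).1⟩, ?_, ?_⟩
  · intro χ h1 h2 h3 h4
    simp only [neg_mul, integral_neg]
    exact neg_nonneg.2 (hsup χ h1 h2 h3 (by simpa using h4))
  · intro χ h1 h2 h3 h4
    simp only [neg_mul, integral_neg]
    exact neg_nonpos.2 (hsub χ h1 h2 h3 (by simpa using h4))

lemma integral_radialTest_nonpos (h : IsDOPSolution φm φp u) {y : Rd d} {t : ℝ} (ht : 0 < t)
    (hy : Metric.closedBall y t ⊆ {x | u x < φp x}) :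
    ∫ x, u x * lapRd (radialTest y t) x ≤ 0 :=
  h.2.2.2.2 _ (contDiff_radialTest y t) (hasCompactSupport_radialTest y ht)
    (radialTest_nonneg y t) ((tsupport_radialTest_subset y ht).trans hy)

lemma integral_neg_radialTest_nonpos (h : IsDOPSolution φm φp u) {y : Rd d} {t : ℝ} (ht : 0 < t)
    (hy : Metric.closedBall y t ⊆ {x | φm x < u x}) :
    ∫ x, -u x * lapRd (radialTest y t) x ≤ 0 :=
  h.neg.integral_radialTest_nonpos ht fun x hx => by simpa using hy hx

lemma frontier_nonempty (h : IsDOPSolution φm φp u) (hlt : ∀ x, φm x < φp x)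
    (hnc : ∃ x y, φm x ≠ φm y) (hmaxmin : ∃ x y, φp x < φm y) :
    (frontier {y | u y = φm y}).Nonempty := by
  rw [nonempty_frontier_iff]
  constructor
  · by_contra hempty
    rw [Set.not_nonempty_iff_eq_empty, Set.eq_empty_iff_forall_notMem] at hempty
    have hgt (x : Rd d) : φm x < u x := lt_of_le_of_ne (h.2.2.1 x).1 (Ne.symm (hempty x))
    obtain ⟨a, b, hab⟩ := hmaxmin
    have := h.neg.2.1.eq_of_superharmonic h.neg.1
      (fun y t ht => h.integral_neg_radialTest_nonpos ht fun x _ => hgt x) a b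
    linarith [hgt b, (h.2.2.1 a).2]
  · intro huniv
    have heq (x : Rd d) : u x = φm x := Set.eq_univ_iff_forall.1 huniv x
    obtain ⟨a, b, hab⟩ := hnc
    have := h.2.1.eq_of_superharmonic h.1
      (fun y t ht => h.integral_radialTest_nonpos ht fun x _ => (heq x).trans_lt (hlt x)) a b
    exact hab (by rw [← heq a, ← heq b, this])

end IsDOPSolution

/-- Averaging kernels at comparable scales about nearby points are comparable. -/
lemma exists_avgKernel_le (d : ℕ) : ∃ A > 0, ∀ (x y : Rd d) (r : ℝ), 0 < r → dist x y ≤ r →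
    ∀ z, avgKernel x (r / 2) z ≤ A * avgKernel y (4 * r) z := by
  obtain ⟨a, ha, hmin⟩ := (isCompact_Icc (a := (1 / 2 : ℝ)) (b := 1)).exists_isMinOn
    (Set.nonempty_Icc.2 (by norm_num)) continuous_glueDeriv.continuousOn
  obtain ⟨b, hb, hmax⟩ := (isCompact_Icc (a := (0 : ℝ)) (b := 1)).exists_isMaxOn
    (Set.nonempty_Icc.2 (by norm_num)) continuous_glueDeriv.continuousOn
  have hm : 0 < glueDeriv a := glueDeriv_pos (by linarith [ha.1])
  have hM : 0 < glueDeriv b := (glueDeriv_pos one_pos).trans_le (hmax ⟨zero_le_one, le_rfl⟩)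
  refine ⟨8 ^ d * glueDeriv b / glueDeriv a, by positivity, fun x y r hr hxy z => ?_⟩
  rcases le_or_gt (r / 2) ‖z - x‖ with hz | hz
  · rw [avgKernel_eq_zero x (by positivity) hz]
    exact mul_nonneg (by positivity) (avgKernel_nonneg y (by positivity) z)
  have hzy : ‖z - y‖ ≤ 2 * r := by
    have := norm_sub_le_norm_sub_add_norm_sub z x y
    rw [dist_eq_norm] at hxy
    linarith
  have hx : glueDeriv (1 - ‖z - x‖ ^ 2 / (r / 2) ^ 2) ≤ glueDeriv b := by
    refine hmax ⟨?_, sub_le_self _ (by positivity)⟩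
    rw [sub_nonneg, div_le_one (by positivity)]
    exact pow_le_pow_left₀ (norm_nonneg _) hz.le 2
  have hy : glueDeriv a ≤ glueDeriv (1 - ‖z - y‖ ^ 2 / (4 * r) ^ 2) := by
    refine hmin ⟨?_, sub_le_self _ (by positivity)⟩
    have : ‖z - y‖ ^ 2 / (4 * r) ^ 2 ≤ 1 / 2 := by
      rw [div_le_iff₀ (by positivity)]
      nlinarith [norm_nonneg (z - y)]
    linarith
  calc avgKernel x (r / 2) z ≤ ((r / 2) ^ d)⁻¹ * glueDeriv b :=
        mul_le_mul_of_nonneg_left hx (by positivity)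
    _ = 8 ^ d * glueDeriv b / glueDeriv a * (((4 * r) ^ d)⁻¹ * glueDeriv a) := by
        rw [show 4 * r = 8 * (r / 2) by ring, mul_pow]
        field_simp
    _ ≤ 8 ^ d * glueDeriv b / glueDeriv a * avgKernel y (4 * r) z :=
        mul_le_mul_of_nonneg_left (mul_le_mul_of_nonneg_left hy (by positivity)) (by positivity)

/-- An open ball whose radius is at most the distance from its center to `frontier s`
and whose center is outside `s` does not meet `s`. -/
lemma disjoint_ball_infDist_frontier {s : Set (Rd d)} {x : Rd d} (hx : x ∉ s) :
    Disjoint (Metric.ball x (Metric.infDist x (frontier s))) s := by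
  rw [Set.disjoint_left]
  intro z hz hzs
  have hpos : 0 < Metric.infDist x (frontier s) := Metric.nonempty_ball.1 ⟨z, hz⟩
  have hcover (w : Rd d) (hw : w ∈ Metric.ball x (Metric.infDist x (frontier s)))
      (hwc : w ∈ closure s) : w ∈ interior s := by
    by_contra hwi
    rw [Metric.mem_ball, dist_comm] at hw
    exact hw.not_ge (Metric.infDist_le_dist_of_mem ⟨hwc, hwi⟩)
  refine hx (interior_subset (IsPreconnected.subset_left_of_subset_union
    (v := (closure s)ᶜ) isOpen_interior isClosed_closure.isOpen_compl ?_ ?_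
    ⟨z, hz, hcover z hz (subset_closure hzs)⟩
    (convex_ball x _).isPreconnected (Metric.mem_ball_self hpos)))
  · exact Set.disjoint_compl_right_iff_subset.2 interior_subset_closure
  · exact fun w hw => or_iff_not_imp_right.2 fun hwc => hcover w hw (not_not.1 hwc)

/-- Quadratic growth away from the lower contact set. -/
lemma IsDOPSolution.sub_le_infDist_sq {φm φp u : Rd d → ℝ} (h : IsDOPSolution φm φp u) {τ : ℝ}
    (hτ : 0 < τ) (hmreg : ContDiff ℝ 2 φm) (hmper : PeriodicRd φm) (hnc : ∃ x y, φm x ≠ φm y)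
    (hsep : ∀ x, τ ≤ φp x - φm x) (hmaxmin : ∃ x y, φp x < φm y) :
    ∃ C₀ > 0, ∃ C > 0, ∀ x, Metric.infDist x (frontier {y | u y = φm y}) ≤ 1 / C₀ →
      u x - φm x ≤ C * sSup (Set.range fun y => |lapRd φm y|) *
        Metric.infDist x (frontier {y | u y = φm y}) ^ 2 := by
  have hd : 1 ≤ d := by
    rcases d with _ | n
    · obtain ⟨x, y, hxy⟩ := hnc
      exact absurd (congrArg φm (Subsingleton.elim x y)) hxy
    · omega
  have hu := h.1
  have hle (x : Rd d) : φm x ≤ u x := (h.2.2.1 x).1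
  have hfr := h.frontier_nonempty (fun x => by linarith [hsep x]) hnc hmaxmin
  have hclosed : IsClosed {y | u y = φm y} := isClosed_eq hu hmreg.continuous
  set S := frontier {y | u y = φm y}
  set K := sSup (Set.range fun y => |lapRd φm y|)
  have hKlap (x : Rd d) : |lapRd φm x| ≤ K :=
    le_csSup (PeriodicRd.bddAbove_range (fun y j => congrArg abs (hmper.lapRd y j))
      (continuous_lapRd hmreg).abs) ⟨x, rfl⟩
  have hK : 0 ≤ K := (abs_nonneg _).trans (hKlap 0)
  obtain ⟨δ, hδ, hunif⟩ := PeriodicRd.exists_uniform_delta (f := fun x => u x - φm x)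
    (fun x j => congrArg₂ (· - ·) (h.2.1 x j) (hmper x j)) (hu.sub hmreg.continuous) hτ
  obtain ⟨A, hA, hker⟩ := exists_avgKernel_le d
  refine ⟨8 / δ, by positivity, 16 * A + 1, by positivity, fun x hx => ?_⟩
  set r := Metric.infDist x S
  have hr0 : 0 ≤ r := Metric.infDist_nonneg
  by_cases hxm : u x = φm x
  · rw [hxm, sub_self]
    positivity
  obtain ⟨y, hyS, hxy⟩ := isClosed_frontier.exists_infDist_eq_dist hfr x
  have hy : u y = φm y := hclosed.frontier_subset hyS
  have hr : 0 < r := hr0.lt_of_ne fun h0 => hxm <| by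
    rw [show x = y from dist_eq_zero.1 (hxy.symm.trans h0.symm), hy]
  have hrδ : 4 * r < δ := by
    rw [one_div_div] at hx
    linarith
  have hcontact : Metric.closedBall y (4 * r) ⊆ {z | u z < φp z} := fun z hz => by
    have hz' := hunif z y ((Metric.mem_closedBall.1 hz).trans_lt hrδ)
    rw [hy, sub_self, dist_zero_right, norm_eq_abs] at hz'
    have := (le_abs_self _).trans_lt hz'
    simp only [Set.mem_ofPred_eq]
    linarith [hsep z]
  have hfree : Metric.closedBall x (r / 2) ⊆ {z | φm z < u z} := fun z hz =>
    (hle z).lt_of_ne fun hzm => Set.disjoint_left.1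
      (disjoint_ball_infDist_frontier (s := {y | u y = φm y}) hxm)
      (Metric.closedBall_subset_ball (by linarith) hz) hzm.symm
  have hupper := integral_sub_mul_avgKernel_le hd hu hmreg hK
    (fun z => (abs_le.1 (hKlap z)).1) y (R := 4 * r) (by positivity) fun t ht htR =>
      h.integral_radialTest_nonpos ht ((Metric.closedBall_subset_closedBall htR).trans hcontact)
  have hlower := integral_sub_mul_avgKernel_le hd hu.neg hmreg.neg hK
    (fun z => by
      have := lapRd_neg φm z
      change -K ≤ lapRd (fun y => -φm y) z
      linarith [(abs_le.1 (hKlap z)).2]) x (R := r / 2) (by positivity) fun t ht htR =>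
      h.integral_neg_radialTest_nonpos ht
        ((Metric.closedBall_subset_closedBall htR).trans hfree)
  have hw : Continuous fun z => u z - φm z := hu.sub hmreg.continuous
  have hcompare : ∫ z, (u z - φm z) * avgKernel x (r / 2) z
      ≤ A * ∫ z, (u z - φm z) * avgKernel y (4 * r) z := by
    rw [← integral_const_mul]
    refine integral_mono (integrable_mul_avgKernel hw x (by positivity))
      ((integrable_mul_avgKernel hw y (by positivity)).const_mul A) fun z => ?_
    have := mul_le_mul_of_nonneg_left (hker x y r hr hxy.ge z) (sub_nonneg.2 (hle z))
    simp only
    linarith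
  have hneg : ∫ z, (-u z - -φm z) * avgKernel x (r / 2) z
      = -∫ z, (u z - φm z) * avgKernel x (r / 2) z := by
    rw [← integral_neg]
    exact integral_congr_ae (Filter.Eventually.of_forall fun z => by simp only; ring)
  simp only [Pi.neg_apply] at hlower
  rw [hneg] at hlower
  rw [hy, sub_self, zero_add] at hupper
  have hmass := avgMass_pos d
  have hAupper := mul_le_mul_of_nonneg_left hupper hA.le
  refine le_of_mul_le_mul_left ?_ hmass
  nlinarith [mul_nonneg hmass.le (mul_nonneg hK (sq_nonneg r))]

/-- **Proposition (quadratic growth near the free boundary).** -/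
theorem dop_quadratic_growth {d : ℕ}
    (φm φp : Rd d → ℝ) (τ : ℝ) (hτ : 0 < τ)
    (hmreg : ContDiff ℝ 2 φm) (hpreg : ContDiff ℝ 2 φp)
    (hmper : PeriodicRd φm) (hpper : PeriodicRd φp)
    (hmnc : ∃ x y : Rd d, φm x ≠ φm y) (hpnc : ∃ x y : Rd d, φp x ≠ φp y)
    (hsep : ∀ x : Rd d, τ ≤ φp x - φm x)
    (hmaxmin : sInf (Set.range φp) < sSup (Set.range φm)) :
    ∀ u : Rd d → ℝ, IsDOPSolution φm φp u →
      ∃ C₀ > 0, ∃ C > 0, ∀ x : Rd d,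
        (Metric.infDist x (frontier {y | u y = φm y}) ≤ 1 / C₀ →
          0 ≤ u x - φm x ∧
          u x - φm x ≤ C * sSup (Set.range fun y => |lapRd φm y|) *
            Metric.infDist x (frontier {y | u y = φm y}) ^ 2) ∧
        (Metric.infDist x (frontier {y | u y = φp y}) ≤ 1 / C₀ →
          0 ≤ φp x - u x ∧
          φp x - u x ≤ C * sSup (Set.range fun y => |lapRd φp y|) *
            Metric.infDist x (frontier {y | u y = φp y}) ^ 2) := by
  intro u hu
  obtain ⟨_, ⟨a, rfl⟩, hlt⟩ := exists_lt_of_lt_csSup (Set.range_nonempty φm) hmaxmin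
  obtain ⟨_, ⟨b, rfl⟩, hba⟩ := exists_lt_of_csInf_lt (Set.range_nonempty φp) hlt
  obtain ⟨D₁, hD₁, C₁, hC₁, h₁⟩ :=
    hu.sub_le_infDist_sq hτ hmreg hmper hmnc hsep ⟨b, a, hba⟩
  obtain ⟨D₂, hD₂, C₂, hC₂, h₂⟩ := hu.neg.sub_le_infDist_sq hτ hpreg.neg hpper.neg
    (by simpa using hpnc) (fun x => by linarith [hsep x]) ⟨a, b, neg_lt_neg hba⟩
  simp only [lapRd_neg, abs_neg, neg_inj, neg_sub_neg] at h₂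
  have hsup (f : Rd d → ℝ) : 0 ≤ sSup (Set.range fun y => |lapRd f y|) :=
    Real.sSup_nonneg (by rintro _ ⟨y, rfl⟩; exact abs_nonneg _)
  refine ⟨max D₁ D₂, lt_max_of_lt_left hD₁, max C₁ C₂, lt_max_of_lt_left hC₁, fun x =>
    ⟨fun hx => ⟨sub_nonneg.2 (hu.2.2.1 x).1, ?_⟩, fun hx => ⟨sub_nonneg.2 (hu.2.2.1 x).2, ?_⟩⟩⟩
  · refine (h₁ x (hx.trans (one_div_le_one_div_of_le hD₁ (le_max_left _ _)))).trans ?_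
    have := hsup φm
    gcongr
    exact le_max_left _ _
  · refine (h₂ x (hx.trans (one_div_le_one_div_of_le hD₂ (le_max_right _ _)))).trans ?_
    have := hsup φp
    gcongr
    exact le_max_right _ _
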